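/- The algebra R(α) (with the product-form polynomials P_i, Q_{i,j} built from the index sets Λ_{i,j}) admits a ℤ-grading as an ℍ-algebra (where deg ℏ_a = 2) determined by: deg e(ν) = 0, deg x_k e(ν) = 2, and deg r_l e(ν) = 2(l_{ν_l} − 1) if ν_l = ν_{l+1} and deg r_l e(ν) = 2 h_{ν_l, ν_{l+1}} if ν_l ≠ ν_{l+1}, where l_i = #Λ_{i,i} and h_{i,j} = #Λ_{i,j}; i.e., all defining relations of R(α) are homogeneous with respect to these degree assignments. -/

import Mathlib

open MvPolynomial

/-- The base ring `ℍ = ℂ[ℏ_a : a ∈ ⊔_{i,j} Λ_{i,j}]`. -/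
abbrev HRing (I : Type) (Λ : I → I → Type) : Type :=
  MvPolynomial ((i : I) × (j : I) × Λ i j) ℂ

/-- The generator `ℏ_a` for `a ∈ Λ_{i,j}`. -/
noncomputable def hbar (I : Type) (Λ : I → I → Type) (i j : I) (a : Λ i j) : HRing I Λ :=
  X ⟨i, j, a⟩

/-- `I^α`: the set of all sequences obtained by permuting the fixed sequence `ν₀`
(equivalently, all sequences `ν` with `α_{ν_1} + ⋯ + α_{ν_m} = α`). -/
noncomputable def Ialpha (I : Type) [DecidableEq I] (m : ℕ) (ν₀ : Fin m → I) :
    Finset (Fin m → I) :=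
  Finset.image (fun σ : Equiv.Perm (Fin m) => ν₀ ∘ σ) Finset.univ

/-- Elements of `I^α`. -/
abbrev Idx (I : Type) [DecidableEq I] (m : ℕ) (ν₀ : Fin m → I) : Type :=
  {ν : Fin m → I // ν ∈ Ialpha I m ν₀}

/-- Generators of the Khovanov-Lauda-Rouquier algebra: the idempotents `e(ν)`,
the polynomial generators `x_k` and the intertwiners `r_t`. -/
inductive KLRGen (I : Type) [DecidableEq I] (m : ℕ) (ν₀ : Fin m → I) : Type where
  | e : Idx I m ν₀ → KLRGen I m ν₀
  | x : Fin m → KLRGen I m ν₀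
  | r : {t : ℕ // t + 1 < m} → KLRGen I m ν₀

/-- The free `ℍ`-algebra on the generators. -/
abbrev KLRFree (I : Type) [DecidableEq I] (Λ : I → I → Type) (m : ℕ) (ν₀ : Fin m → I) :
    Type :=
  FreeAlgebra (HRing I Λ) (KLRGen I m ν₀)

section
variable (I : Type) [DecidableEq I] (Λ : I → I → Type) [∀ i j, Fintype (Λ i j)]
  (m : ℕ) (ν₀ : Fin m → I)

noncomputable def ge (ν : Idx I m ν₀) : KLRFree I Λ m ν₀ :=
  FreeAlgebra.ι _ (KLRGen.e ν)

noncomputable def gx (k : Fin m) : KLRFree I Λ m ν₀ :=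
  FreeAlgebra.ι _ (KLRGen.x k)

noncomputable def gr (t : {t : ℕ // t + 1 < m}) : KLRFree I Λ m ν₀ :=
  FreeAlgebra.ι _ (KLRGen.r t)

/-- `t` as an element of `Fin m`. -/
def fa (t : {t : ℕ // t + 1 < m}) : Fin m := ⟨t.1, Nat.lt_of_succ_lt t.2⟩

/-- `t+1` as an element of `Fin m`. -/
def fb (t : {t : ℕ // t + 1 < m}) : Fin m := ⟨t.1 + 1, t.2⟩

/-- The action of the transposition `s_t` on `I^α`. -/
noncomputable def sAct (t : {t : ℕ // t + 1 < m}) (ν : Idx I m ν₀) : Idx I m ν₀ :=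
  ⟨ν.1 ∘ Equiv.swap (fa m t) (fb m t), by
    obtain ⟨σ, -, hσ⟩ := Finset.mem_image.1 ν.2
    refine Finset.mem_image.2 ⟨σ * Equiv.swap (fa m t) (fb m t), Finset.mem_univ _, ?_⟩
    rw [← hσ]
    ext k
    simp [Equiv.Perm.coe_mul, Function.comp]⟩

/-- The commutative polynomial ring in three variables over `ℍ`, used to write down the
coefficient polynomials of the defining relations. -/
abbrev CPol : Type := MvPolynomial (Fin 3) (HRing I Λ)

/-- `P_i(u,v) = ∏_{a ∈ Λ_{i,i}} (u − v + ℏ_a)`. -/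
noncomputable def Pc (i : I) (u v : CPol I Λ) : CPol I Λ :=
  ∏ a : Λ i i, (u - v + C (hbar I Λ i i a))

/-- `Q_{i,j}(u,v)`: zero if `i = j`, and
`∏_{a ∈ Λ_{i,j}} (v − u + ℏ_a) · ∏_{a ∈ Λ_{j,i}} (u − v + ℏ_a)` otherwise. -/
noncomputable def Qc (i j : I) (u v : CPol I Λ) : CPol I Λ :=
  if i = j then 0
  else (∏ a : Λ i j, (v - u + C (hbar I Λ i j a))) * (∏ a : Λ j i, (u - v + C (hbar I Λ j i a)))

/-- Noncommutative evaluation (in a fixed monomial order) of a commutative polynomial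
at the elements `g 0`, `g 1`, `g 2` of the free algebra. -/
noncomputable def ncEval (g : Fin 3 → KLRFree I Λ m ν₀) (p : CPol I Λ) :
    KLRFree I Λ m ν₀ :=
  ∑ s ∈ p.support,
    algebraMap (HRing I Λ) (KLRFree I Λ m ν₀) (MvPolynomial.coeff s p) *
      ((g 0) ^ (s 0) * ((g 1) ^ (s 1) * (g 2) ^ (s 2)))

/-- Evaluation at `x_t`, `x_{t+1}` (third variable unused). -/
noncomputable def gv (t : {t : ℕ // t + 1 < m}) : Fin 3 → KLRFree I Λ m ν₀ :=
  ![gx I Λ m ν₀ (fa m t), gx I Λ m ν₀ (fb m t), 1]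

/-- Evaluation at `x_t`, `x_{t+1}`, `x_{t+2}`. -/
noncomputable def gv3 (t : ℕ) (h2 : t + 2 < m) : Fin 3 → KLRFree I Λ m ν₀ :=
  ![gx I Λ m ν₀ ⟨t, by omega⟩, gx I Λ m ν₀ ⟨t + 1, by omega⟩, gx I Λ m ν₀ ⟨t + 2, h2⟩]

end
/-- The defining relations of the Khovanov-Lauda-Rouquier algebra `R(α)` associated with
the data `(Λ_{i,j})`, with `P_i`, `Q_{i,j}` the product-form polynomials.  Divided
differences (`∂_t P`, `Q̄_{i,j}`, `P̄'`, `P̄''`) are encoded by their defining identities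
in the commutative coefficient ring. -/
inductive KLRRel (I : Type) [DecidableEq I] (Λ : I → I → Type) [∀ i j, Fintype (Λ i j)]
    (m : ℕ) (ν₀ : Fin m → I) : KLRFree I Λ m ν₀ → KLRFree I Λ m ν₀ → Prop where
  | e_orth (ν ν' : Idx I m ν₀) (h : ν ≠ ν') :
      KLRRel I Λ m ν₀ (ge I Λ m ν₀ ν * ge I Λ m ν₀ ν') 0
  | e_idem (ν : Idx I m ν₀) :
      KLRRel I Λ m ν₀ (ge I Λ m ν₀ ν * ge I Λ m ν₀ ν) (ge I Λ m ν₀ ν)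
  | e_sum :
      KLRRel I Λ m ν₀ (∑ ν ∈ (Ialpha I m ν₀).attach, ge I Λ m ν₀ ν) 1
  | x_e (k : Fin m) (ν : Idx I m ν₀) :
      KLRRel I Λ m ν₀ (gx I Λ m ν₀ k * ge I Λ m ν₀ ν) (ge I Λ m ν₀ ν * gx I Λ m ν₀ k)
  | x_x (k l : Fin m) :
      KLRRel I Λ m ν₀ (gx I Λ m ν₀ k * gx I Λ m ν₀ l) (gx I Λ m ν₀ l * gx I Λ m ν₀ k)
  | r_e (t : {t : ℕ // t + 1 < m}) (ν : Idx I m ν₀) :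
      KLRRel I Λ m ν₀ (gr I Λ m ν₀ t * ge I Λ m ν₀ ν)
        (ge I Λ m ν₀ (sAct I m ν₀ t ν) * gr I Λ m ν₀ t)
  | r_r_far (t s : {t : ℕ // t + 1 < m}) (h : t.1 + 1 < s.1 ∨ s.1 + 1 < t.1) :
      KLRRel I Λ m ν₀ (gr I Λ m ν₀ t * gr I Λ m ν₀ s) (gr I Λ m ν₀ s * gr I Λ m ν₀ t)
  | rr_eq (t : {t : ℕ // t + 1 < m}) (ν : Idx I m ν₀)
      (h : ν.1 (fa m t) = ν.1 (fb m t)) (g : CPol I Λ)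
      (hg : (X 0 - X 1) * g =
        Pc I Λ (ν.1 (fa m t)) (X 1) (X 0) - Pc I Λ (ν.1 (fa m t)) (X 0) (X 1)) :
      KLRRel I Λ m ν₀ (gr I Λ m ν₀ t * gr I Λ m ν₀ t * ge I Λ m ν₀ ν)
        (ncEval I Λ m ν₀ (gv I Λ m ν₀ t) g * (gr I Λ m ν₀ t * ge I Λ m ν₀ ν))
  | rr_ne (t : {t : ℕ // t + 1 < m}) (ν : Idx I m ν₀)
      (h : ν.1 (fa m t) ≠ ν.1 (fb m t)) :
      KLRRel I Λ m ν₀ (gr I Λ m ν₀ t * gr I Λ m ν₀ t * ge I Λ m ν₀ ν)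
        (ncEval I Λ m ν₀ (gv I Λ m ν₀ t)
            (Qc I Λ (ν.1 (fa m t)) (ν.1 (fb m t)) (X 0) (X 1)) * ge I Λ m ν₀ ν)
  | r_x_far (t : {t : ℕ // t + 1 < m}) (k : Fin m) (hk1 : k ≠ fa m t) (hk2 : k ≠ fb m t)
      (ν : Idx I m ν₀) :
      KLRRel I Λ m ν₀ (gr I Λ m ν₀ t * gx I Λ m ν₀ k * ge I Λ m ν₀ ν)
        (gx I Λ m ν₀ k * (gr I Λ m ν₀ t * ge I Λ m ν₀ ν))
  | r_x_t_ne (t : {t : ℕ // t + 1 < m}) (ν : Idx I m ν₀)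
      (h : ν.1 (fa m t) ≠ ν.1 (fb m t)) :
      KLRRel I Λ m ν₀ (gr I Λ m ν₀ t * gx I Λ m ν₀ (fa m t) * ge I Λ m ν₀ ν)
        (gx I Λ m ν₀ (fb m t) * (gr I Λ m ν₀ t * ge I Λ m ν₀ ν))
  | r_x_t1_ne (t : {t : ℕ // t + 1 < m}) (ν : Idx I m ν₀)
      (h : ν.1 (fa m t) ≠ ν.1 (fb m t)) :
      KLRRel I Λ m ν₀ (gr I Λ m ν₀ t * gx I Λ m ν₀ (fb m t) * ge I Λ m ν₀ ν)
        (gx I Λ m ν₀ (fa m t) * (gr I Λ m ν₀ t * ge I Λ m ν₀ ν))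
  | r_x_t_eq (t : {t : ℕ // t + 1 < m}) (ν : Idx I m ν₀)
      (h : ν.1 (fa m t) = ν.1 (fb m t)) :
      KLRRel I Λ m ν₀ (gr I Λ m ν₀ t * gx I Λ m ν₀ (fa m t) * ge I Λ m ν₀ ν)
        (gx I Λ m ν₀ (fb m t) * (gr I Λ m ν₀ t * ge I Λ m ν₀ ν)
          - ncEval I Λ m ν₀ (gv I Λ m ν₀ t) (Pc I Λ (ν.1 (fa m t)) (X 0) (X 1)) *
              ge I Λ m ν₀ ν)
  | r_x_t1_eq (t : {t : ℕ // t + 1 < m}) (ν : Idx I m ν₀)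
      (h : ν.1 (fa m t) = ν.1 (fb m t)) :
      KLRRel I Λ m ν₀ (gr I Λ m ν₀ t * gx I Λ m ν₀ (fb m t) * ge I Λ m ν₀ ν)
        (gx I Λ m ν₀ (fa m t) * (gr I Λ m ν₀ t * ge I Λ m ν₀ ν)
          + ncEval I Λ m ν₀ (gv I Λ m ν₀ t) (Pc I Λ (ν.1 (fa m t)) (X 0) (X 1)) *
              ge I Λ m ν₀ ν)
  | braid_far (t : ℕ) (h2 : t + 2 < m) (ν : Idx I m ν₀)
      (h : ν.1 ⟨t, by omega⟩ ≠ ν.1 ⟨t + 2, h2⟩) :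
      KLRRel I Λ m ν₀
        (gr I Λ m ν₀ ⟨t + 1, by omega⟩ * gr I Λ m ν₀ ⟨t, by omega⟩ *
            gr I Λ m ν₀ ⟨t + 1, by omega⟩ * ge I Λ m ν₀ ν)
        (gr I Λ m ν₀ ⟨t, by omega⟩ * gr I Λ m ν₀ ⟨t + 1, by omega⟩ *
            gr I Λ m ν₀ ⟨t, by omega⟩ * ge I Λ m ν₀ ν)
  | braid_Q (t : ℕ) (h2 : t + 2 < m) (ν : Idx I m ν₀)
      (hac : ν.1 ⟨t, by omega⟩ = ν.1 ⟨t + 2, h2⟩)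
      (hab : ν.1 ⟨t, by omega⟩ ≠ ν.1 ⟨t + 1, by omega⟩)
      (q : CPol I Λ)
      (hq : (X 0 - X 2) * q =
        Qc I Λ (ν.1 ⟨t, by omega⟩) (ν.1 ⟨t + 1, by omega⟩) (X 0) (X 1)
          - Qc I Λ (ν.1 ⟨t, by omega⟩) (ν.1 ⟨t + 1, by omega⟩) (X 2) (X 1)) :
      KLRRel I Λ m ν₀
        (gr I Λ m ν₀ ⟨t + 1, by omega⟩ * gr I Λ m ν₀ ⟨t, by omega⟩ *
            gr I Λ m ν₀ ⟨t + 1, by omega⟩ * ge I Λ m ν₀ ν)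
        (gr I Λ m ν₀ ⟨t, by omega⟩ * gr I Λ m ν₀ ⟨t + 1, by omega⟩ *
            gr I Λ m ν₀ ⟨t, by omega⟩ * ge I Λ m ν₀ ν
          + ncEval I Λ m ν₀ (gv3 I Λ m ν₀ t h2)
              (Pc I Λ (ν.1 ⟨t, by omega⟩) (X 0) (X 2) * q) * ge I Λ m ν₀ ν)
  | braid_P (t : ℕ) (h2 : t + 2 < m) (ν : Idx I m ν₀)
      (hab : ν.1 ⟨t, by omega⟩ = ν.1 ⟨t + 1, by omega⟩)
      (hbc : ν.1 ⟨t + 1, by omega⟩ = ν.1 ⟨t + 2, h2⟩)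
      (p p' : CPol I Λ)
      (hp : ((X 0 - X 1) * ((X 0 - X 2) * (X 1 - X 2))) * p =
        Pc I Λ (ν.1 ⟨t, by omega⟩) (X 1) (X 0) * Pc I Λ (ν.1 ⟨t, by omega⟩) (X 0) (X 2) *
            (X 1 - X 2)
          + Pc I Λ (ν.1 ⟨t, by omega⟩) (X 0) (X 2) * Pc I Λ (ν.1 ⟨t, by omega⟩) (X 1) (X 2) *
            (X 0 - X 1)
          - Pc I Λ (ν.1 ⟨t, by omega⟩) (X 0) (X 1) * Pc I Λ (ν.1 ⟨t, by omega⟩) (X 1) (X 2) *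
            (X 0 - X 2))
      (hp' : ((X 0 - X 1) * ((X 0 - X 2) * (X 1 - X 2))) * p' =
        -(Pc I Λ (ν.1 ⟨t, by omega⟩) (X 0) (X 1) * Pc I Λ (ν.1 ⟨t, by omega⟩) (X 0) (X 2) *
            (X 1 - X 2))
          - Pc I Λ (ν.1 ⟨t, by omega⟩) (X 0) (X 2) * Pc I Λ (ν.1 ⟨t, by omega⟩) (X 2) (X 1) *
            (X 0 - X 1)
          + Pc I Λ (ν.1 ⟨t, by omega⟩) (X 0) (X 1) * Pc I Λ (ν.1 ⟨t, by omega⟩) (X 1) (X 2) *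
            (X 0 - X 2)) :
      KLRRel I Λ m ν₀
        (gr I Λ m ν₀ ⟨t + 1, by omega⟩ * gr I Λ m ν₀ ⟨t, by omega⟩ *
            gr I Λ m ν₀ ⟨t + 1, by omega⟩ * ge I Λ m ν₀ ν)
        (gr I Λ m ν₀ ⟨t, by omega⟩ * gr I Λ m ν₀ ⟨t + 1, by omega⟩ *
            gr I Λ m ν₀ ⟨t, by omega⟩ * ge I Λ m ν₀ ν
          + ncEval I Λ m ν₀ (gv3 I Λ m ν₀ t h2) p *
              (gr I Λ m ν₀ ⟨t, by omega⟩ * ge I Λ m ν₀ ν)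
          + ncEval I Λ m ν₀ (gv3 I Λ m ν₀ t h2) p' *
              (gr I Λ m ν₀ ⟨t + 1, by omega⟩ * ge I Λ m ν₀ ν))

/-- The Khovanov-Lauda-Rouquier algebra `R(α)`. -/
abbrev KLRAlg (I : Type) [DecidableEq I] (Λ : I → I → Type) [∀ i j, Fintype (Λ i j)]
    (m : ℕ) (ν₀ : Fin m → I) : Type :=
  RingQuot (KLRRel I Λ m ν₀)

/-- The quotient map from the free algebra to `R(α)`. -/
noncomputable def klrMk (I : Type) [DecidableEq I] (Λ : I → I → Type)
    [∀ i j, Fintype (Λ i j)] (m : ℕ) (ν₀ : Fin m → I) :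
    KLRFree I Λ m ν₀ →ₐ[HRing I Λ] KLRAlg I Λ m ν₀ :=
  RingQuot.mkAlgHom (HRing I Λ) (KLRRel I Λ m ν₀)
section Scaling

/-- The algebra endomorphism of the base ring multiplying each `ℏ_a` by `2 ^ 2`, where `2` is
the degree of `ℏ_a`. -/
noncomputable def hScale (I : Type) (Λ : I → I → Type) : HRing I Λ →ₐ[ℂ] HRing I Λ :=
  aeval fun a => (2 : ℂ) ^ (2 : ℤ) • X a

lemma hScale_hbar (I : Type) (Λ : I → I → Type) (i j : I) (a : Λ i j) :
    hScale I Λ (hbar I Λ i j a) = (2 : ℂ) ^ (2 : ℤ) • hbar I Λ i j a :=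
  aeval_X _ _

variable {I : Type} {Λ : I → I → Type}

/-- The ring endomorphism of the coefficient ring extending `hScale` and multiplying the `i`-th
variable by `2 ^ w i`. -/
noncomputable def wScale (w : Fin 3 → ℤ) : CPol I Λ →+* CPol I Λ :=
  eval₂Hom ((C : HRing I Λ →+* CPol I Λ).comp (hScale I Λ).toRingHom)
    fun i => (2 : ℂ) ^ w i • X i

/-- Homogeneity of degree `n` when `X i` has degree `w i` and each `ℏ_a` has degree `2`. -/
def IsWHomog (w : Fin 3 → ℤ) (p : CPol I Λ) (n : ℤ) : Prop :=
  wScale w p = (2 : ℂ) ^ n • p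

variable {w : Fin 3 → ℤ} {p q : CPol I Λ} {n k : ℤ}

lemma isWHomog_X {i : Fin 3} (h : w i = n) : IsWHomog w (X i : CPol I Λ) n := by
  simp [IsWHomog, wScale, h]

lemma wScale_C (c : HRing I Λ) : wScale w (C c) = C (hScale I Λ c) :=
  eval₂_C _ _ _

lemma isWHomog_C_hbar (i j : I) (a : Λ i j) :
    IsWHomog w (C (hbar I Λ i j a) : CPol I Λ) 2 := by
  rw [IsWHomog, wScale_C, hScale_hbar, C_apply, C_apply, smul_monomial]

namespace IsWHomog

lemma mul (hp : IsWHomog w p n) (hq : IsWHomog w q k) : IsWHomog w (p * q) (n + k) := by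
  rw [IsWHomog, map_mul, hp, hq, smul_mul_smul_comm, zpow_add₀ two_ne_zero]

lemma add (hp : IsWHomog w p n) (hq : IsWHomog w q n) : IsWHomog w (p + q) n := by
  rw [IsWHomog, map_add, hp, hq, smul_add]

lemma neg (hp : IsWHomog w p n) : IsWHomog w (-p) n := by
  rw [IsWHomog, map_neg, hp, smul_neg]

lemma sub (hp : IsWHomog w p n) (hq : IsWHomog w q n) : IsWHomog w (p - q) n := by
  rw [IsWHomog, map_sub, hp, hq, smul_sub]

lemma prod {ι : Type*} (s : Finset ι) (f : ι → CPol I Λ) (h : ∀ a ∈ s, IsWHomog w (f a) n) :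
    IsWHomog w (∏ a ∈ s, f a) (n * s.card) := by
  rw [IsWHomog, map_prod, Finset.prod_congr rfl h, Finset.prod_smul, Finset.prod_const,
    zpow_mul, zpow_natCast]

lemma of_mul_eq {r : CPol I Λ} (hr : IsWHomog w r k) (hp : IsWHomog w p n) (hp0 : p ≠ 0)
    (h : p * q = r) : IsWHomog w q (k - n) := by
  have h2 : (2 : ℂ) ^ n ≠ 0 := zpow_ne_zero _ two_ne_zero
  have h' : (2 : ℂ) ^ n • (p * wScale w q) = (2 : ℂ) ^ k • (p * q) := by
    rw [h, ← hr, ← h, map_mul, hp, smul_mul_assoc]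
  rw [IsWHomog, zpow_sub₀ two_ne_zero, div_eq_inv_mul, mul_smul]
  apply mul_left_cancel₀ hp0
  rw [mul_smul_comm, mul_smul_comm, ← h', inv_smul_smul₀ h2]

end IsWHomog

lemma isWHomog_X_sub_X {i j : Fin 3} (hi : w i = n) (hj : w j = n) :
    IsWHomog w (X i - X j : CPol I Λ) n :=
  (isWHomog_X hi).sub (isWHomog_X hj)

lemma X_sub_X_ne_zero {i j : Fin 3} (h : i ≠ j) : (X i - X j : CPol I Λ) ≠ 0 :=
  sub_ne_zero.2 fun e => h (X_injective e)

lemma wScale_monomial (s : Fin 3 →₀ ℕ) (c : HRing I Λ) :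
    wScale w (monomial s c) =
      monomial s ((2 : ℂ) ^ (w 0 * s 0 + w 1 * s 1 + w 2 * s 2) • hScale I Λ c) := by
  have hX (i : Fin 3) : wScale w (X i ^ s i : CPol I Λ) = (2 : ℂ) ^ (w i * s i) • X i ^ s i := by
    rw [map_pow, isWHomog_X rfl, smul_pow, zpow_mul, zpow_natCast]
  have h2 : (2 : ℂ) ≠ 0 := two_ne_zero
  rw [← smul_monomial, monomial_eq, monomial_eq, Finsupp.prod_fintype _ _ (by simp),
    Fin.prod_univ_three, map_mul, map_mul, map_mul, hX, hX, hX, wScale_C, smul_mul_smul_comm,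
    smul_mul_smul_comm, mul_smul_comm, zpow_add₀ h2, zpow_add₀ h2]

lemma coeff_wScale (s : Fin 3 →₀ ℕ) (p : CPol I Λ) :
    coeff s (wScale w p) =
      (2 : ℂ) ^ (w 0 * s 0 + w 1 * s 1 + w 2 * s 2) • hScale I Λ (coeff s p) := by
  classical
  induction p using MvPolynomial.induction_on' with
  | monomial u c =>
    rw [wScale_monomial, coeff_monomial, coeff_monomial]
    split_ifs with h
    · rw [h]
    · simp
  | add p q hp hq => simp [hp, hq]

lemma IsWHomog.hScale_coeff (hp : IsWHomog w p n) (s : Fin 3 →₀ ℕ) :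
    hScale I Λ (coeff s p) =
      (2 : ℂ) ^ (n - (w 0 * s 0 + w 1 * s 1 + w 2 * s 2)) • coeff s p := by
  have h2 : (2 : ℂ) ^ (w 0 * s 0 + w 1 * s 1 + w 2 * s 2) ≠ 0 := zpow_ne_zero _ two_ne_zero
  have h := congrArg (coeff s) hp
  rw [coeff_wScale, coeff_smul] at h
  rw [zpow_sub₀ two_ne_zero, div_eq_inv_mul, mul_smul, ← h, inv_smul_smul₀ h2]

lemma IsWHomog.of_vandermonde_mul_eq {r : CPol I Λ} (h0 : w 0 = 2) (h1 : w 1 = 2) (h2 : w 2 = 2)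
    (hr : IsWHomog w r k) (h : (X 0 - X 1) * ((X 0 - X 2) * (X 1 - X 2)) * q = r) :
    IsWHomog w q (k - (2 + (2 + 2))) :=
  hr.of_mul_eq ((isWHomog_X_sub_X h0 h1).mul
      ((isWHomog_X_sub_X h0 h2).mul (isWHomog_X_sub_X h1 h2)))
    (mul_ne_zero (X_sub_X_ne_zero (by decide))
      (mul_ne_zero (X_sub_X_ne_zero (by decide)) (X_sub_X_ne_zero (by decide)))) h

variable [∀ i j, Fintype (Λ i j)]

lemma isWHomog_Pc (a : I) {i j : Fin 3} (hi : w i = 2) (hj : w j = 2) :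
    IsWHomog w (Pc I Λ a (X i) (X j)) (2 * Fintype.card (Λ a a)) :=
  IsWHomog.prod _ _ fun c _ => (isWHomog_X_sub_X hi hj).add (isWHomog_C_hbar a a c)

lemma isWHomog_Qc [DecidableEq I] {a b : I} (hab : a ≠ b) {i j : Fin 3}
    (hi : w i = 2) (hj : w j = 2) :
    IsWHomog w (Qc I Λ a b (X i) (X j))
      (2 * Fintype.card (Λ a b) + 2 * Fintype.card (Λ b a)) := by
  rw [Qc, if_neg hab]
  exact (IsWHomog.prod _ _ fun c _ => (isWHomog_X_sub_X hj hi).add (isWHomog_C_hbar a b c)).mul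
    (IsWHomog.prod _ _ fun c _ => (isWHomog_X_sub_X hi hj).add (isWHomog_C_hbar b a c))

lemma isWHomog_divDiff_Pc {a : I} (h0 : w 0 = 2) (h1 : w 1 = 2)
    (h : (X 0 - X 1) * q = Pc I Λ a (X 1) (X 0) - Pc I Λ a (X 0) (X 1)) :
    IsWHomog w q (2 * Fintype.card (Λ a a) - 2) :=
  ((isWHomog_Pc a h1 h0).sub (isWHomog_Pc a h0 h1)).of_mul_eq (isWHomog_X_sub_X h0 h1)
    (X_sub_X_ne_zero (by decide)) h

lemma isWHomog_divDiff_Qc [DecidableEq I] {a b : I} (hab : a ≠ b)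
    (h0 : w 0 = 2) (h1 : w 1 = 2) (h2 : w 2 = 2)
    (h : (X 0 - X 2) * q = Qc I Λ a b (X 0) (X 1) - Qc I Λ a b (X 2) (X 1)) :
    IsWHomog w q (2 * Fintype.card (Λ a b) + 2 * Fintype.card (Λ b a) - 2) :=
  ((isWHomog_Qc hab h0 h1).sub (isWHomog_Qc hab h2 h1)).of_mul_eq (isWHomog_X_sub_X h0 h2)
    (X_sub_X_ne_zero (by decide)) h

lemma isWHomog_braid_left {a : I} (h0 : w 0 = 2) (h1 : w 1 = 2) (h2 : w 2 = 2)
    (h : (X 0 - X 1) * ((X 0 - X 2) * (X 1 - X 2)) * q =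
      Pc I Λ a (X 1) (X 0) * Pc I Λ a (X 0) (X 2) * (X 1 - X 2)
        + Pc I Λ a (X 0) (X 2) * Pc I Λ a (X 1) (X 2) * (X 0 - X 1)
        - Pc I Λ a (X 0) (X 1) * Pc I Λ a (X 1) (X 2) * (X 0 - X 2)) :
    IsWHomog w q (2 * Fintype.card (Λ a a) + 2 * Fintype.card (Λ a a) + 2 - (2 + (2 + 2))) :=
  .of_vandermonde_mul_eq h0 h1 h2
    (((((isWHomog_Pc a h1 h0).mul (isWHomog_Pc a h0 h2)).mul (isWHomog_X_sub_X h1 h2)).add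
      (((isWHomog_Pc a h0 h2).mul (isWHomog_Pc a h1 h2)).mul (isWHomog_X_sub_X h0 h1))).sub
      (((isWHomog_Pc a h0 h1).mul (isWHomog_Pc a h1 h2)).mul (isWHomog_X_sub_X h0 h2))) h

lemma isWHomog_braid_right {a : I} (h0 : w 0 = 2) (h1 : w 1 = 2) (h2 : w 2 = 2)
    (h : (X 0 - X 1) * ((X 0 - X 2) * (X 1 - X 2)) * q =
      -(Pc I Λ a (X 0) (X 1) * Pc I Λ a (X 0) (X 2) * (X 1 - X 2))
        - Pc I Λ a (X 0) (X 2) * Pc I Λ a (X 2) (X 1) * (X 0 - X 1)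
        + Pc I Λ a (X 0) (X 1) * Pc I Λ a (X 1) (X 2) * (X 0 - X 2)) :
    IsWHomog w q (2 * Fintype.card (Λ a a) + 2 * Fintype.card (Λ a a) + 2 - (2 + (2 + 2))) :=
  .of_vandermonde_mul_eq h0 h1 h2
    (((((isWHomog_Pc a h0 h1).mul (isWHomog_Pc a h0 h2)).mul (isWHomog_X_sub_X h1 h2)).neg.sub
      (((isWHomog_Pc a h0 h2).mul (isWHomog_Pc a h2 h1)).mul (isWHomog_X_sub_X h0 h1))).add
      (((isWHomog_Pc a h0 h1).mul (isWHomog_Pc a h1 h2)).mul (isWHomog_X_sub_X h0 h2))) h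

end Scaling

section FreeAlgebra

variable {R A : Type*} [CommSemiring R] [Semiring A] {Y : Type*}

/-- The ring homomorphism from a free algebra extending a central homomorphism of the scalars. -/
noncomputable def freeLift (φ : R →+* A) (hφ : ∀ c x, φ c * x = x * φ c) (g : Y → A) :
    FreeAlgebra R Y →+* A :=
  letI := φ.toAlgebra' hφ
  (FreeAlgebra.lift R g).toRingHom

variable (φ : R →+* A) (hφ : ∀ c x, φ c * x = x * φ c) (g : Y → A)

lemma freeLift_ι (y : Y) : freeLift φ hφ g (FreeAlgebra.ι R y) = g y :=
  letI := φ.toAlgebra' hφ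
  FreeAlgebra.lift_ι_apply g y

lemma freeLift_algebraMap (c : R) : freeLift φ hφ g (algebraMap R _ c) = φ c :=
  letI := φ.toAlgebra' hφ
  (FreeAlgebra.lift R g).commutes c

end FreeAlgebra

section Twist

variable (I : Type) [DecidableEq I] (Λ : I → I → Type) [∀ i j, Fintype (Λ i j)]
  (m : ℕ) (ν₀ : Fin m → I)

/-- The degree of `r_t e(ν)` when `ν_t = i` and `ν_{t+1} = j`. -/
def pairDeg (i j : I) : ℤ :=
  if i = j then 2 * (Fintype.card (Λ i i) : ℤ) - 2 else 2 * (Fintype.card (Λ i j) : ℤ)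

/-- The degree of `r_t e(ν)`. -/
def rDeg (t : {t : ℕ // t + 1 < m}) (ν : Idx I m ν₀) : ℤ :=
  pairDeg I Λ (ν.1 (fa m t)) (ν.1 (fb m t))

/-- The images of the generators under multiplication by `2 ^ d` in each degree `d`. -/
noncomputable def twistGen : KLRGen I m ν₀ → KLRAlg I Λ m ν₀
  | .e ν => klrMk I Λ m ν₀ (ge I Λ m ν₀ ν)
  | .x k => (2 : ℂ) ^ (2 : ℤ) • klrMk I Λ m ν₀ (gx I Λ m ν₀ k)
  | .r t => ∑ ν ∈ (Ialpha I m ν₀).attach,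
      (2 : ℂ) ^ rDeg I Λ m ν₀ t ν • klrMk I Λ m ν₀ (gr I Λ m ν₀ t * ge I Λ m ν₀ ν)

/-- Multiplication by `2 ^ d` in each degree `d`, as a map out of the free algebra. -/
noncomputable def freeTwist : KLRFree I Λ m ν₀ →+* KLRAlg I Λ m ν₀ :=
  freeLift ((algebraMap (HRing I Λ) (KLRAlg I Λ m ν₀)).comp (hScale I Λ).toRingHom)
    (fun c x => Algebra.commutes (hScale I Λ c) x) (twistGen I Λ m ν₀)

variable {I Λ m ν₀}

lemma klrMk_rel {a b : KLRFree I Λ m ν₀} (h : KLRRel I Λ m ν₀ a b) :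
    klrMk I Λ m ν₀ a = klrMk I Λ m ν₀ b :=
  RingQuot.mkAlgHom_rel _ h

lemma klrMk_smul (c : ℂ) (u : KLRFree I Λ m ν₀) :
    klrMk I Λ m ν₀ (c • u) = c • klrMk I Λ m ν₀ u :=
  map_smul ((klrMk I Λ m ν₀).restrictScalars ℂ) c u

lemma freeTwist_algebraMap (c : HRing I Λ) :
    freeTwist I Λ m ν₀ (algebraMap _ _ c) = algebraMap _ _ (hScale I Λ c) :=
  freeLift_algebraMap _ _ _ c

lemma freeTwist_ge (ν : Idx I m ν₀) :
    freeTwist I Λ m ν₀ (ge I Λ m ν₀ ν) = klrMk I Λ m ν₀ (ge I Λ m ν₀ ν) :=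
  freeLift_ι _ _ _ _

lemma freeTwist_gx (k : Fin m) :
    freeTwist I Λ m ν₀ (gx I Λ m ν₀ k) = (2 : ℂ) ^ (2 : ℤ) • klrMk I Λ m ν₀ (gx I Λ m ν₀ k) :=
  freeLift_ι _ _ _ _

lemma freeTwist_gr (t : {t : ℕ // t + 1 < m}) :
    freeTwist I Λ m ν₀ (gr I Λ m ν₀ t) = ∑ ν ∈ (Ialpha I m ν₀).attach,
      (2 : ℂ) ^ rDeg I Λ m ν₀ t ν • klrMk I Λ m ν₀ (gr I Λ m ν₀ t * ge I Λ m ν₀ ν) :=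
  freeLift_ι _ _ _ _

lemma klrMk_ge_mul_ge (ν ν' : Idx I m ν₀) :
    klrMk I Λ m ν₀ (ge I Λ m ν₀ ν) * klrMk I Λ m ν₀ (ge I Λ m ν₀ ν') =
      if ν = ν' then klrMk I Λ m ν₀ (ge I Λ m ν₀ ν) else 0 := by
  rw [← map_mul]
  split_ifs with h
  · subst h
    exact klrMk_rel (.e_idem ν)
  · rw [klrMk_rel (.e_orth ν ν' h), map_zero]

lemma sum_klrMk_ge :
    ∑ ν ∈ (Ialpha I m ν₀).attach, klrMk I Λ m ν₀ (ge I Λ m ν₀ ν) = 1 := by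
  rw [← map_sum, klrMk_rel .e_sum, map_one]

variable (I Λ m ν₀) in
/-- The elements `u` whose image in `R(α)` lies in `e(μ) R(α)` and is multiplied by `2 ^ n` under
the twist. -/
noncomputable def twistHomog (μ : Idx I m ν₀) (n : ℤ) : AddSubgroup (KLRFree I Λ m ν₀) where
  carrier := {u | freeTwist I Λ m ν₀ u = (2 : ℂ) ^ n • klrMk I Λ m ν₀ u ∧
    klrMk I Λ m ν₀ (ge I Λ m ν₀ μ) * klrMk I Λ m ν₀ u = klrMk I Λ m ν₀ u}
  zero_mem' := by simp
  add_mem' := by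
    rintro u v ⟨hu, hu'⟩ ⟨hv, hv'⟩
    exact ⟨by rw [map_add, map_add, hu, hv, smul_add], by rw [map_add, mul_add, hu', hv']⟩
  neg_mem' := by
    rintro u ⟨hu, hu'⟩
    have h : ge I Λ m ν₀ μ * -u = -(ge I Λ m ν₀ μ * u)  :=
      eq_neg_of_add_eq_zero_left (by rw [← mul_add, neg_add_cancel, mul_zero])
    exact ⟨by rw [map_neg, map_neg, hu, smul_neg],
      by rw [← map_mul, h, map_neg, map_neg, map_mul, hu']⟩

variable {μ : Idx I m ν₀} {n k : ℤ} {u v : KLRFree I Λ m ν₀}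

lemma freeTwist_eq_of_rel (hu : u ∈ twistHomog I Λ m ν₀ μ n) (hv : v ∈ twistHomog I Λ m ν₀ μ n)
    (h : KLRRel I Λ m ν₀ u v) : freeTwist I Λ m ν₀ u = freeTwist I Λ m ν₀ v := by
  rw [hu.1, hv.1, klrMk_rel h]

lemma ge_mem (ν : Idx I m ν₀) : ge I Λ m ν₀ ν ∈ twistHomog I Λ m ν₀ ν 0 :=
  ⟨by rw [freeTwist_ge, zpow_zero, one_smul], by rw [klrMk_ge_mul_ge, if_pos rfl]⟩

lemma gx_mul_mem (i : Fin m) (hu : u ∈ twistHomog I Λ m ν₀ μ n) :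
    gx I Λ m ν₀ i * u ∈ twistHomog I Λ m ν₀ μ (n + 2) := by
  refine ⟨?_, ?_⟩
  · rw [map_mul, map_mul, freeTwist_gx, hu.1, smul_mul_smul_comm, add_comm n,
      zpow_add₀ two_ne_zero]
  · rw [map_mul, ← mul_assoc, ← map_mul, ← klrMk_rel (.x_e i μ), map_mul, mul_assoc, hu.2]

lemma freeTwist_gr_mul_ge (t : {t : ℕ // t + 1 < m}) (ν : Idx I m ν₀) :
    freeTwist I Λ m ν₀ (gr I Λ m ν₀ t) * klrMk I Λ m ν₀ (ge I Λ m ν₀ ν) =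
      (2 : ℂ) ^ rDeg I Λ m ν₀ t ν • klrMk I Λ m ν₀ (gr I Λ m ν₀ t * ge I Λ m ν₀ ν) := by
  rw [freeTwist_gr, Finset.sum_mul, Finset.sum_eq_single_of_mem ν (Finset.mem_attach _ _)]
  · rw [smul_mul_assoc, map_mul, mul_assoc, klrMk_ge_mul_ge, if_pos rfl]
  · intro ν' _ h
    rw [smul_mul_assoc, map_mul, mul_assoc, klrMk_ge_mul_ge, if_neg h, mul_zero, smul_zero]

lemma gr_mul_mem (t : {t : ℕ // t + 1 < m}) (hu : u ∈ twistHomog I Λ m ν₀ μ n) :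
    gr I Λ m ν₀ t * u ∈ twistHomog I Λ m ν₀ (sAct I m ν₀ t μ) (n + rDeg I Λ m ν₀ t μ) := by
  refine ⟨?_, ?_⟩
  · rw [map_mul, map_mul, hu.1, ← hu.2, mul_smul_comm, ← mul_assoc, freeTwist_gr_mul_ge,
      smul_mul_assoc, smul_smul, zpow_add₀ two_ne_zero, map_mul, mul_assoc]
  · rw [map_mul, ← mul_assoc, ← map_mul, ← klrMk_rel (.r_e t μ), map_mul, mul_assoc, hu.2]

lemma pow_mul_mem {g : KLRFree I Λ m ν₀}
    (hg : ∀ n u, u ∈ twistHomog I Λ m ν₀ μ n → g * u ∈ twistHomog I Λ m ν₀ μ (n + k))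
    (hu : u ∈ twistHomog I Λ m ν₀ μ n) (s : ℕ) :
    g ^ s * u ∈ twistHomog I Λ m ν₀ μ (n + k * s) := by
  induction s with
  | zero => simpa using hu
  | succ s ih =>
    rw [pow_succ', mul_assoc]
    convert hg _ _ ih using 2
    push_cast
    ring

lemma ncEval_mul_mem {w : Fin 3 → ℤ} {p : CPol I Λ} {g : Fin 3 → KLRFree I Λ m ν₀}
    (hg : ∀ i n u, u ∈ twistHomog I Λ m ν₀ μ n → g i * u ∈ twistHomog I Λ m ν₀ μ (n + w i))
    (hp : IsWHomog w p k) (hu : u ∈ twistHomog I Λ m ν₀ μ n) :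
    ncEval I Λ m ν₀ g p * u ∈ twistHomog I Λ m ν₀ μ (n + k) := by
  rw [ncEval, Finset.sum_mul]
  refine sum_mem fun s _ => ?_
  have h := pow_mul_mem (hg 0) (pow_mul_mem (hg 1) (pow_mul_mem (hg 2) hu (s 2)) (s 1)) (s 0)
  rw [mul_assoc, mul_assoc, mul_assoc]
  refine ⟨?_, ?_⟩
  · rw [(freeTwist I Λ m ν₀).map_mul (algebraMap _ _ _), h.1, map_mul (klrMk I Λ m ν₀) (algebraMap _ _ _), freeTwist_algebraMap, hp.hScale_coeff, AlgHom.commutes,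
      ← IsScalarTower.algebraMap_smul (HRing I Λ) ((2 : ℂ) ^ (k - _)), smul_eq_mul, map_mul,
      ← IsScalarTower.algebraMap_apply, mul_assoc, ← Algebra.smul_def, mul_smul_comm, smul_smul,
      ← zpow_add₀ two_ne_zero]
    congr 2
    ring
  · rw [map_mul, AlgHom.commutes, ← mul_assoc, ← Algebra.commutes, mul_assoc, h.2]

lemma gv_mul_mem (t : {t : ℕ // t + 1 < m}) (i : Fin 3) (n : ℤ) (u : KLRFree I Λ m ν₀)
    (hu : u ∈ twistHomog I Λ m ν₀ μ n) :
    gv I Λ m ν₀ t i * u ∈ twistHomog I Λ m ν₀ μ (n + ![2, 2, 0] i) := by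
  fin_cases i
  · exact gx_mul_mem _ hu
  · exact gx_mul_mem _ hu
  · simpa [gv] using hu

lemma gv3_mul_mem (t : ℕ) (h2 : t + 2 < m) (i : Fin 3) (n : ℤ) (u : KLRFree I Λ m ν₀)
    (hu : u ∈ twistHomog I Λ m ν₀ μ n) :
    gv3 I Λ m ν₀ t h2 i * u ∈ twistHomog I Λ m ν₀ μ (n + ![2, 2, 2] i) := by
  fin_cases i <;> exact gx_mul_mem _ hu

lemma sAct_apply (t : {t : ℕ // t + 1 < m}) (ν : Idx I m ν₀) (i : Fin m) :
    (sAct I m ν₀ t ν).1 i = if i.1 = t.1 then ν.1 (fb m t)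
      else if i.1 = t.1 + 1 then ν.1 (fa m t) else ν.1 i := by
  simp only [sAct, Function.comp_apply, Equiv.swap_apply_def, Fin.ext_iff, fa, fb]
  split_ifs <;> rfl

lemma sAct_sAct (t : {t : ℕ // t + 1 < m}) (ν : Idx I m ν₀) :
    sAct I m ν₀ t (sAct I m ν₀ t ν) = ν := by
  refine Subtype.ext (funext fun i => ?_)
  simp [sAct]

lemma sAct_eq_self {t : {t : ℕ // t + 1 < m}} {ν : Idx I m ν₀}
    (h : ν.1 (fa m t) = ν.1 (fb m t)) : sAct I m ν₀ t ν = ν := by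
  refine Subtype.ext (funext fun i => ?_)
  rw [sAct_apply]
  split_ifs with h1 h2
  · rw [← h]
    exact congrArg ν.1 (Fin.ext h1.symm)
  · rw [h]
    exact congrArg ν.1 (Fin.ext h2.symm)
  · rfl

lemma sAct_comm {t s : {t : ℕ // t + 1 < m}} (h : t.1 + 1 < s.1 ∨ s.1 + 1 < t.1)
    (ν : Idx I m ν₀) :
    sAct I m ν₀ t (sAct I m ν₀ s ν) = sAct I m ν₀ s (sAct I m ν₀ t ν) := by
  refine Subtype.ext (funext fun i => ?_)
  simp only [sAct_apply, fa, fb]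
  split_ifs <;> first | rfl | omega

lemma sAct_braid (t : ℕ) (h2 : t + 2 < m) (ν : Idx I m ν₀) :
    sAct I m ν₀ ⟨t, by omega⟩ (sAct I m ν₀ ⟨t + 1, by omega⟩ (sAct I m ν₀ ⟨t, by omega⟩ ν)) =
      sAct I m ν₀ ⟨t + 1, by omega⟩
        (sAct I m ν₀ ⟨t, by omega⟩ (sAct I m ν₀ ⟨t + 1, by omega⟩ ν)) := by
  refine Subtype.ext (funext fun i => ?_)
  simp only [sAct_apply, fa, fb]
  split_ifs <;> first | rfl | omega

lemma sAct_braid_eq_self (t : ℕ) (h2 : t + 2 < m) (ν : Idx I m ν₀)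
    (h : ν.1 ⟨t, by omega⟩ = ν.1 ⟨t + 2, h2⟩) :
    sAct I m ν₀ ⟨t + 1, by omega⟩
      (sAct I m ν₀ ⟨t, by omega⟩ (sAct I m ν₀ ⟨t + 1, by omega⟩ ν)) = ν := by
  refine Subtype.ext (funext fun i => ?_)
  obtain ⟨i, hi⟩ := i
  simp only [sAct_apply, fa, fb]
  split_ifs <;> first | rfl | omega | (subst_vars; first | rfl | exact h | exact h.symm)

lemma rDeg_sAct_far {t s : {t : ℕ // t + 1 < m}} (h : t.1 + 1 < s.1 ∨ s.1 + 1 < t.1)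
    (ν : Idx I m ν₀) : rDeg I Λ m ν₀ t (sAct I m ν₀ s ν) = rDeg I Λ m ν₀ t ν := by
  simp only [rDeg, sAct_apply, fa, fb]
  split_ifs <;> first | rfl | omega

lemma rDeg_sAct (t : {t : ℕ // t + 1 < m}) (ν : Idx I m ν₀) :
    rDeg I Λ m ν₀ t (sAct I m ν₀ t ν) = pairDeg I Λ (ν.1 (fb m t)) (ν.1 (fa m t)) := by
  simp [rDeg, sAct]

lemma mem_congr {μ' : Idx I m ν₀} (hu : u ∈ twistHomog I Λ m ν₀ μ n) (hμ : μ = μ') (hn : n = k) :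
    u ∈ twistHomog I Λ m ν₀ μ' k :=
  hμ ▸ hn ▸ hu

lemma gr_mul_ge_mem (t : {t : ℕ // t + 1 < m}) (ν : Idx I m ν₀) :
    gr I Λ m ν₀ t * ge I Λ m ν₀ ν ∈
      twistHomog I Λ m ν₀ (sAct I m ν₀ t ν) (rDeg I Λ m ν₀ t ν) :=
  mem_congr (gr_mul_mem t (ge_mem ν)) rfl (zero_add _)

lemma gr_mul_gx_mul_ge_mem (t : {t : ℕ // t + 1 < m}) (i : Fin m) (ν : Idx I m ν₀) :
    gr I Λ m ν₀ t * gx I Λ m ν₀ i * ge I Λ m ν₀ ν ∈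
      twistHomog I Λ m ν₀ (sAct I m ν₀ t ν) (rDeg I Λ m ν₀ t ν + 2) := by
  rw [mul_assoc]
  exact mem_congr (gr_mul_mem t (gx_mul_mem i (ge_mem ν))) rfl (by ring)

lemma gx_mul_gr_mul_ge_mem (t : {t : ℕ // t + 1 < m}) (i : Fin m) (ν : Idx I m ν₀) :
    gx I Λ m ν₀ i * (gr I Λ m ν₀ t * ge I Λ m ν₀ ν) ∈
      twistHomog I Λ m ν₀ (sAct I m ν₀ t ν) (rDeg I Λ m ν₀ t ν + 2) :=
  gx_mul_mem i (gr_mul_ge_mem t ν)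

lemma gr_mul_gr_mul_ge_mem (t s : {t : ℕ // t + 1 < m}) (ν : Idx I m ν₀) :
    gr I Λ m ν₀ t * gr I Λ m ν₀ s * ge I Λ m ν₀ ν ∈
      twistHomog I Λ m ν₀ (sAct I m ν₀ t (sAct I m ν₀ s ν))
        (rDeg I Λ m ν₀ s ν + rDeg I Λ m ν₀ t (sAct I m ν₀ s ν)) := by
  rw [mul_assoc]
  exact gr_mul_mem t (gr_mul_ge_mem s ν)

lemma ncEval_Pc_mul_ge_mem (t : {t : ℕ // t + 1 < m}) (ν : Idx I m ν₀)
    (h : ν.1 (fa m t) = ν.1 (fb m t)) :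
    ncEval I Λ m ν₀ (gv I Λ m ν₀ t) (Pc I Λ (ν.1 (fa m t)) (X 0) (X 1)) * ge I Λ m ν₀ ν ∈
      twistHomog I Λ m ν₀ (sAct I m ν₀ t ν) (rDeg I Λ m ν₀ t ν + 2) := by
  refine mem_congr (ncEval_mul_mem (gv_mul_mem t)
    (isWHomog_Pc _ rfl rfl) (ge_mem ν)) (sAct_eq_self h).symm ?_
  rw [rDeg, pairDeg, if_pos h]
  ring

lemma braid_left_mem (t : ℕ) (h2 : t + 2 < m) (ν : Idx I m ν₀) :
    gr I Λ m ν₀ ⟨t + 1, by omega⟩ * gr I Λ m ν₀ ⟨t, by omega⟩ *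
        gr I Λ m ν₀ ⟨t + 1, by omega⟩ * ge I Λ m ν₀ ν ∈
      twistHomog I Λ m ν₀
        (sAct I m ν₀ ⟨t + 1, by omega⟩
          (sAct I m ν₀ ⟨t, by omega⟩ (sAct I m ν₀ ⟨t + 1, by omega⟩ ν)))
        (pairDeg I Λ (ν.1 ⟨t, by omega⟩) (ν.1 ⟨t + 1, by omega⟩) +
          pairDeg I Λ (ν.1 ⟨t, by omega⟩) (ν.1 ⟨t + 2, h2⟩) +
          pairDeg I Λ (ν.1 ⟨t + 1, by omega⟩) (ν.1 ⟨t + 2, h2⟩)) := by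
  rw [mul_assoc, mul_assoc]
  refine mem_congr (gr_mul_mem _ (gr_mul_mem _ (gr_mul_ge_mem _ ν))) rfl ?_
  have h3 : t + 1 + 1 ≠ t := by omega
  simp [rDeg, sAct_apply, fa, fb, h3, h3.symm]
  ring

lemma braid_right_mem (t : ℕ) (h2 : t + 2 < m) (ν : Idx I m ν₀) :
    gr I Λ m ν₀ ⟨t, by omega⟩ * gr I Λ m ν₀ ⟨t + 1, by omega⟩ *
        gr I Λ m ν₀ ⟨t, by omega⟩ * ge I Λ m ν₀ ν ∈
      twistHomog I Λ m ν₀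
        (sAct I m ν₀ ⟨t + 1, by omega⟩
          (sAct I m ν₀ ⟨t, by omega⟩ (sAct I m ν₀ ⟨t + 1, by omega⟩ ν)))
        (pairDeg I Λ (ν.1 ⟨t, by omega⟩) (ν.1 ⟨t + 1, by omega⟩) +
          pairDeg I Λ (ν.1 ⟨t, by omega⟩) (ν.1 ⟨t + 2, h2⟩) +
          pairDeg I Λ (ν.1 ⟨t + 1, by omega⟩) (ν.1 ⟨t + 2, h2⟩)) := by
  rw [mul_assoc, mul_assoc]
  refine mem_congr (gr_mul_mem _ (gr_mul_mem _ (gr_mul_ge_mem _ ν))) (sAct_braid t h2 ν) ?_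
  have h3 : t + 1 + 1 ≠ t := by omega
  simp [rDeg, sAct_apply, fa, fb, h3, h3.symm]

lemma freeTwist_gr_mul_gr (t s : {t : ℕ // t + 1 < m}) :
    freeTwist I Λ m ν₀ (gr I Λ m ν₀ t * gr I Λ m ν₀ s) = ∑ ν ∈ (Ialpha I m ν₀).attach,
      freeTwist I Λ m ν₀ (gr I Λ m ν₀ t * gr I Λ m ν₀ s * ge I Λ m ν₀ ν) := by
  simp_rw [(freeTwist I Λ m ν₀).map_mul _ (ge I Λ m ν₀ _), freeTwist_ge, ← Finset.mul_sum,
    sum_klrMk_ge, mul_one]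

lemma freeTwist_rel {a b : KLRFree I Λ m ν₀} (h : KLRRel I Λ m ν₀ a b) :
    freeTwist I Λ m ν₀ a = freeTwist I Λ m ν₀ b := by
  cases h with
  | e_orth ν ν' h =>
    rw [map_mul, freeTwist_ge, freeTwist_ge, klrMk_ge_mul_ge, if_neg h, map_zero]
  | e_idem ν => rw [map_mul, freeTwist_ge, klrMk_ge_mul_ge, if_pos rfl]
  | e_sum => simp_rw [map_sum, freeTwist_ge, sum_klrMk_ge, map_one]
  | x_e k ν =>
    rw [map_mul, map_mul, freeTwist_ge, freeTwist_gx, smul_mul_assoc, mul_smul_comm,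
      ← map_mul, ← map_mul, klrMk_rel (.x_e k ν)]
  | x_x k l =>
    rw [map_mul, map_mul, freeTwist_gx, freeTwist_gx, smul_mul_smul_comm, smul_mul_smul_comm,
      ← map_mul, ← map_mul, klrMk_rel (.x_x k l)]
  | r_e t ν =>
    rw [map_mul, map_mul, freeTwist_ge, freeTwist_gr_mul_ge, freeTwist_ge, freeTwist_gr,
      Finset.mul_sum, Finset.sum_eq_single_of_mem ν (Finset.mem_attach _ _)]
    · rw [mul_smul_comm, (gr_mul_ge_mem t ν).2]
    · intro ν' _ h
      rw [mul_smul_comm, map_mul, ← mul_assoc, ← map_mul, ← klrMk_rel (.r_e t ν), map_mul,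
        mul_assoc, klrMk_ge_mul_ge, if_neg h.symm, mul_zero, smul_zero]
  | r_r_far t s h =>
    rw [freeTwist_gr_mul_gr, freeTwist_gr_mul_gr]
    refine Finset.sum_congr rfl fun ν _ => ?_
    rw [(gr_mul_gr_mul_ge_mem t s ν).1, (gr_mul_gr_mul_ge_mem s t ν).1, rDeg_sAct_far h,
      rDeg_sAct_far h.symm, add_comm, map_mul, map_mul _ (gr I Λ m ν₀ s * _),
      klrMk_rel (.r_r_far t s h)]
  | rr_eq t ν h g hg =>
    have hw : IsWHomog ![2, 2, 0] g (rDeg I Λ m ν₀ t ν) := by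
      rw [rDeg, pairDeg, if_pos h]
      exact isWHomog_divDiff_Pc rfl rfl hg
    refine freeTwist_eq_of_rel (gr_mul_gr_mul_ge_mem t t ν) ?_ (.rr_eq t ν h g hg)
    exact mem_congr (ncEval_mul_mem (gv_mul_mem t) hw (gr_mul_ge_mem t ν))
      (by rw [sAct_eq_self h, sAct_eq_self h]) (by rw [sAct_eq_self h])
  | rr_ne t ν h =>
    refine freeTwist_eq_of_rel (gr_mul_gr_mul_ge_mem t t ν) ?_ (.rr_ne t ν h)
    refine mem_congr (ncEval_mul_mem (gv_mul_mem t)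
      (isWHomog_Qc h rfl rfl) (ge_mem ν)) (sAct_sAct t ν).symm ?_
    rw [rDeg_sAct, rDeg, pairDeg, pairDeg, if_neg h, if_neg h.symm, zero_add]
  | r_x_far t k hk1 hk2 ν =>
    exact freeTwist_eq_of_rel (gr_mul_gx_mul_ge_mem t k ν) (gx_mul_gr_mul_ge_mem t k ν)
      (.r_x_far t k hk1 hk2 ν)
  | r_x_t_ne t ν h =>
    exact freeTwist_eq_of_rel (gr_mul_gx_mul_ge_mem t _ ν) (gx_mul_gr_mul_ge_mem t _ ν)
      (.r_x_t_ne t ν h)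
  | r_x_t1_ne t ν h =>
    exact freeTwist_eq_of_rel (gr_mul_gx_mul_ge_mem t _ ν) (gx_mul_gr_mul_ge_mem t _ ν)
      (.r_x_t1_ne t ν h)
  | r_x_t_eq t ν h =>
    exact freeTwist_eq_of_rel (gr_mul_gx_mul_ge_mem t _ ν)
      (sub_mem (gx_mul_gr_mul_ge_mem t _ ν) (ncEval_Pc_mul_ge_mem t ν h)) (.r_x_t_eq t ν h)
  | r_x_t1_eq t ν h =>
    exact freeTwist_eq_of_rel (gr_mul_gx_mul_ge_mem t _ ν)
      (add_mem (gx_mul_gr_mul_ge_mem t _ ν) (ncEval_Pc_mul_ge_mem t ν h)) (.r_x_t1_eq t ν h)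
  | braid_far t h2 ν h =>
    exact freeTwist_eq_of_rel (braid_left_mem t h2 ν) (braid_right_mem t h2 ν)
      (.braid_far t h2 ν h)
  | braid_Q t h2 ν hac hab q hq =>
    refine freeTwist_eq_of_rel (braid_left_mem t h2 ν) (add_mem (braid_right_mem t h2 ν) ?_)
      (.braid_Q t h2 ν hac hab q hq)
    refine mem_congr (ncEval_mul_mem (gv3_mul_mem t h2)
      ((isWHomog_Pc _ rfl rfl).mul (isWHomog_divDiff_Qc hab rfl rfl rfl hq)) (ge_mem ν))
      (sAct_braid_eq_self t h2 ν hac).symm ?_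
    rw [← hac, pairDeg, pairDeg, pairDeg, if_neg hab, if_neg hab.symm, if_pos rfl]
    ring
  | braid_P t h2 ν hab hbc p p' hp hp' =>
    have hμ := sAct_braid_eq_self t h2 ν (hab.trans hbc)
    refine freeTwist_eq_of_rel (braid_left_mem t h2 ν)
      (add_mem (add_mem (braid_right_mem t h2 ν) ?_) ?_)
      (.braid_P t h2 ν hab hbc p p' hp hp')
    · refine mem_congr (ncEval_mul_mem (gv3_mul_mem t h2)
        (isWHomog_braid_left rfl rfl rfl hp) (gr_mul_ge_mem _ ν))
        ((sAct_eq_self hab).trans hμ.symm) ?_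
      simp only [rDeg, fa, fb, ← hbc, ← hab]
      simp only [pairDeg, if_true]
      ring
    · refine mem_congr (ncEval_mul_mem (gv3_mul_mem t h2)
        (isWHomog_braid_right rfl rfl rfl hp') (gr_mul_ge_mem _ ν))
        ((sAct_eq_self hbc).trans hμ.symm) ?_
      simp only [rDeg, fa, fb, ← hbc, ← hab]
      simp only [pairDeg, if_true]
      ring

lemma freeTwist_smul (c : ℂ) (u : KLRFree I Λ m ν₀) :
    freeTwist I Λ m ν₀ (c • u) = c • freeTwist I Λ m ν₀ u := by
  rw [← IsScalarTower.algebraMap_smul (HRing I Λ) c u, Algebra.smul_def, map_mul,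
    freeTwist_algebraMap, AlgHom.commutes, ← Algebra.smul_def, IsScalarTower.algebraMap_smul]

lemma lift_klrMk {A : Type*} [Semiring A] (f : KLRFree I Λ m ν₀ →+* A)
    (hf : ∀ ⦃a b⦄, KLRRel I Λ m ν₀ a b → f a = f b) (u : KLRFree I Λ m ν₀) :
    RingQuot.lift ⟨f, hf⟩ (klrMk I Λ m ν₀ u) = f u := by
  rw [klrMk, ← AlgHom.coe_toRingHom, RingQuot.mkAlgHom_coe]
  exact RingQuot.lift_mkRingHom_apply _ _ _

variable (I Λ m ν₀) in
/-- Multiplication by `2 ^ d` in each degree `d` of `R(α)`. -/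
noncomputable def twist :
    KLRAlg I Λ m ν₀ →ₗ[ℂ] KLRAlg I Λ m ν₀ where
  __ := RingQuot.lift ⟨freeTwist I Λ m ν₀, fun _ _ => freeTwist_rel⟩
  map_smul' c x := by
    obtain ⟨u, rfl⟩ := RingQuot.mkAlgHom_surjective (HRing I Λ) (KLRRel I Λ m ν₀) x
    change RingQuot.lift _ (c • klrMk I Λ m ν₀ u) = c • RingQuot.lift _ (klrMk I Λ m ν₀ u)
    rw [← klrMk_smul, lift_klrMk, lift_klrMk, freeTwist_smul]

lemma twist_klrMk (u : KLRFree I Λ m ν₀) :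
    twist I Λ m ν₀ (klrMk I Λ m ν₀ u) = freeTwist I Λ m ν₀ u :=
  lift_klrMk _ _ u

lemma twist_mul (x y : KLRAlg I Λ m ν₀) :
    twist I Λ m ν₀ (x * y) = twist I Λ m ν₀ x * twist I Λ m ν₀ y :=
  map_mul (RingQuot.lift ⟨freeTwist I Λ m ν₀, fun _ _ => freeTwist_rel⟩) x y

variable (I Λ m ν₀) in
/-- The degree `n` part of `R(α)`. -/
noncomputable def degPart (n : ℤ) : Submodule ℂ (KLRAlg I Λ m ν₀) :=
  LinearMap.eqLocus (twist I Λ m ν₀) ((2 : ℂ) ^ n • LinearMap.id)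

lemma mem_degPart {x : KLRAlg I Λ m ν₀} :
    x ∈ degPart I Λ m ν₀ n ↔ twist I Λ m ν₀ x = (2 : ℂ) ^ n • x :=
  Iff.rfl

lemma mul_mem_degPart {x y : KLRAlg I Λ m ν₀} (hx : x ∈ degPart I Λ m ν₀ n)
    (hy : y ∈ degPart I Λ m ν₀ k) : x * y ∈ degPart I Λ m ν₀ (n + k) := by
  rw [mem_degPart] at *
  rw [twist_mul, hx, hy, smul_mul_smul_comm, zpow_add₀ two_ne_zero]

lemma klrMk_mem_degPart (hu : u ∈ twistHomog I Λ m ν₀ μ n) :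
    klrMk I Λ m ν₀ u ∈ degPart I Λ m ν₀ n := by
  rw [mem_degPart, twist_klrMk, hu.1]

lemma one_mem_degPart : (1 : KLRAlg I Λ m ν₀) ∈ degPart I Λ m ν₀ 0 := by
  rw [← map_one (klrMk I Λ m ν₀), mem_degPart, twist_klrMk, map_one, map_one, zpow_zero, one_smul]

lemma algebraMap_hbar_mem_degPart (i j : I) (a : Λ i j) :
    algebraMap (HRing I Λ) (KLRAlg I Λ m ν₀) (hbar I Λ i j a) ∈ degPart I Λ m ν₀ 2 := by
  rw [mem_degPart, ← AlgHom.commutes (klrMk I Λ m ν₀), twist_klrMk, freeTwist_algebraMap,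
    hScale_hbar, AlgHom.commutes, ← IsScalarTower.algebraMap_smul (HRing I Λ), smul_eq_mul,
    map_mul, ← Algebra.smul_def, IsScalarTower.algebraMap_smul]

lemma klrMk_gx_mem_degPart (i : Fin m) :
    klrMk I Λ m ν₀ (gx I Λ m ν₀ i) ∈ degPart I Λ m ν₀ 2 := by
  rw [mem_degPart, twist_klrMk, freeTwist_gx]

lemma mul_mem_iSup_degPart {x y : KLRAlg I Λ m ν₀} (hx : x ∈ ⨆ n, degPart I Λ m ν₀ n)
    (hy : y ∈ ⨆ n, degPart I Λ m ν₀ n) : x * y ∈ ⨆ n, degPart I Λ m ν₀ n := by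
  induction hx using Submodule.iSup_induction' with
  | zero => rw [zero_mul]; exact zero_mem _
  | add a b _ _ ha hb => rw [add_mul]; exact add_mem ha hb
  | mem n a ha =>
    induction hy using Submodule.iSup_induction' with
    | zero => rw [mul_zero]; exact zero_mem _
    | add c d _ _ hc hd => rw [mul_add]; exact add_mem hc hd
    | mem k c hc => exact Submodule.mem_iSup_of_mem _ (mul_mem_degPart ha hc)

lemma algebraMap_mem_iSup_degPart (c : HRing I Λ) :
    algebraMap (HRing I Λ) (KLRAlg I Λ m ν₀) c ∈ ⨆ n, degPart I Λ m ν₀ n := by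
  induction c using MvPolynomial.induction_on with
  | C c =>
    refine Submodule.mem_iSup_of_mem 0 ?_
    rw [← MvPolynomial.algebraMap_eq, ← IsScalarTower.algebraMap_apply,
      Algebra.algebraMap_eq_smul_one]
    exact Submodule.smul_mem _ _ one_mem_degPart
  | add p q hp hq => rw [map_add]; exact add_mem hp hq
  | mul_X p a hp =>
    rw [map_mul]
    exact mul_mem_iSup_degPart hp
      (Submodule.mem_iSup_of_mem 2 (algebraMap_hbar_mem_degPart a.1 a.2.1 a.2.2))

lemma iSup_degPart : ⨆ n, degPart I Λ m ν₀ n = ⊤ := by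
  refine Submodule.eq_top_iff'.2 fun x => ?_
  obtain ⟨u, rfl⟩ := RingQuot.mkAlgHom_surjective (HRing I Λ) (KLRRel I Λ m ν₀) x
  change klrMk I Λ m ν₀ u ∈ _
  induction u using FreeAlgebra.induction with
  | grade0 c => rw [AlgHom.commutes]; exact algebraMap_mem_iSup_degPart c
  | grade1 y =>
    cases y with
    | e ν => exact Submodule.mem_iSup_of_mem _ (klrMk_mem_degPart (ge_mem ν))
    | x i => exact Submodule.mem_iSup_of_mem _ (klrMk_gx_mem_degPart i)
    | r t =>
      change klrMk I Λ m ν₀ (gr I Λ m ν₀ t) ∈ _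
      rw [← mul_one (klrMk I Λ m ν₀ (gr I Λ m ν₀ t)), ← sum_klrMk_ge, Finset.mul_sum]
      refine sum_mem fun ν _ => ?_
      rw [← map_mul]
      exact Submodule.mem_iSup_of_mem _ (klrMk_mem_degPart (gr_mul_ge_mem t ν))
  | mul a b ha hb => rw [map_mul]; exact mul_mem_iSup_degPart ha hb
  | add a b ha hb => rw [map_add]; exact add_mem ha hb

end Twist

lemma two_zpow_injective : Function.Injective fun n : ℤ => (2 : ℂ) ^ n := fun a b h => by
  have h' : ((2 : ℝ) ^ a : ℝ) = 2 ^ b := Complex.ofReal_injective (by push_cast; exact h)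
  exact zpow_right_injective₀ two_pos (by norm_num) h'

lemma isInternal_eqLocus {M : Type*} [AddCommMonoid M] [Module ℂ M] (f : M →ₗ[ℂ] M)
    {𝒜 : ℤ → Submodule ℂ M} (h𝒜 : ∀ n x, x ∈ 𝒜 n ↔ f x = (2 : ℂ) ^ n • x) (h : ⨆ n, 𝒜 n = ⊤) :
    DirectSum.IsInternal 𝒜 := by
  let _ : AddCommGroup M := Module.addCommMonoidToAddCommGroup ℂ
  have he : 𝒜 = fun n : ℤ => Module.End.eigenspace f ((2 : ℂ) ^ n) :=
    funext fun n => Submodule.ext fun x => (h𝒜 n x).trans Module.End.mem_eigenspace_iff.symm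
  refine (DirectSum.isInternal_submodule_iff_iSupIndep_and_iSup_eq_top 𝒜).2 ⟨?_, h⟩
  rw [he]
  exact (Module.End.eigenspaces_iSupIndep f).comp two_zpow_injective

lemma isInternal_degPart (I : Type) [DecidableEq I] (Λ : I → I → Type) [∀ i j, Fintype (Λ i j)]
    (m : ℕ) (ν₀ : Fin m → I) : DirectSum.IsInternal (degPart I Λ m ν₀) := by
  have h (n : ℤ) (x : KLRAlg I Λ m ν₀) := mem_degPart (n := n) (x := x)
  exact isInternal_eqLocus (twist I Λ m ν₀) h iSup_degPart

/-- The algebra `R(α)` admits a `ℤ`-grading (as a `ℂ`-algebra, with `deg ℏ_a = 2`)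
determined by `deg e(ν) = 0`, `deg x_k e(ν) = 2`, and
`deg r_l e(ν) = 2(l_{ν_l} − 1)` if `ν_l = ν_{l+1}`, `deg r_l e(ν) = 2 h_{ν_l, ν_{l+1}}`
if `ν_l ≠ ν_{l+1}`, where `l_i = #Λ_{i,i}` and `h_{i,j} = #Λ_{i,j}`. -/
theorem stmt17 (I : Type) [DecidableEq I] (Λ : I → I → Type) [∀ i j, Fintype (Λ i j)]
    (m : ℕ) (ν₀ : Fin m → I) :
    ∃ 𝒜 : ℤ → Submodule ℂ (KLRAlg I Λ m ν₀),
      DirectSum.IsInternal 𝒜 ∧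
      (1 : KLRAlg I Λ m ν₀) ∈ 𝒜 0 ∧
      (∀ (n n' : ℤ) (x y : KLRAlg I Λ m ν₀), x ∈ 𝒜 n → y ∈ 𝒜 n' → x * y ∈ 𝒜 (n + n')) ∧
      (∀ (i j : I) (a : Λ i j),
        algebraMap (HRing I Λ) (KLRAlg I Λ m ν₀) (hbar I Λ i j a) ∈ 𝒜 2) ∧
      (∀ ν : Idx I m ν₀, klrMk I Λ m ν₀ (ge I Λ m ν₀ ν) ∈ 𝒜 0) ∧
      (∀ (k : Fin m) (ν : Idx I m ν₀),
        klrMk I Λ m ν₀ (gx I Λ m ν₀ k * ge I Λ m ν₀ ν) ∈ 𝒜 2) ∧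
      (∀ (t : {t : ℕ // t + 1 < m}) (ν : Idx I m ν₀),
        ν.1 (fa m t) = ν.1 (fb m t) →
        klrMk I Λ m ν₀ (gr I Λ m ν₀ t * ge I Λ m ν₀ ν) ∈
          𝒜 (2 * (Fintype.card (Λ (ν.1 (fa m t)) (ν.1 (fa m t))) : ℤ) - 2)) ∧
      (∀ (t : {t : ℕ // t + 1 < m}) (ν : Idx I m ν₀),
        ν.1 (fa m t) ≠ ν.1 (fb m t) →
        klrMk I Λ m ν₀ (gr I Λ m ν₀ t * ge I Λ m ν₀ ν) ∈
          𝒜 (2 * (Fintype.card (Λ (ν.1 (fa m t)) (ν.1 (fb m t))) : ℤ))) := by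
  have hx (k : Fin m) (ν : Idx I m ν₀) :
      gx I Λ m ν₀ k * ge I Λ m ν₀ ν ∈ twistHomog I Λ m ν₀ ν 2 :=
    mem_congr (gx_mul_mem k (ge_mem ν)) rfl (zero_add 2)
  refine ⟨degPart I Λ m ν₀, isInternal_degPart I Λ m ν₀, one_mem_degPart,
    fun _ _ _ _ => mul_mem_degPart, algebraMap_hbar_mem_degPart,
    fun ν => klrMk_mem_degPart (ge_mem ν), fun k ν => klrMk_mem_degPart (hx k ν),
    fun t ν h => ?_, fun t ν h => ?_⟩
  · have := klrMk_mem_degPart (gr_mul_ge_mem (Λ := Λ) t ν)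
    rwa [rDeg, pairDeg, if_pos h] at this
  · have := klrMk_mem_degPart (gr_mul_ge_mem (Λ := Λ) t ν)
    rwa [rDeg, pairDeg, if_neg h] at this
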